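/- Let d ≤ k be positive integers, let D ∈ ℝ^{d×k} have full rank d, let V ∈ ℝ^{k×k} be symmetric positive definite, and let M ∈ ℝ^{k×k} be symmetric positive definite. Then the matrices D M Dᵗ, D M V M Dᵗ and D V⁻¹ Dᵗ are invertible and, in the Loewner (positive semidefinite) order, D M Dᵗ [D M V M Dᵗ]⁻¹ D M Dᵗ ≤ D V⁻¹ Dᵗ; moreover, for M = V⁻¹ equality holds, i.e. D V⁻¹ Dᵗ [D V⁻¹ Dᵗ]⁻¹ D V⁻¹ Dᵗ = D V⁻¹ Dᵗ. -/

import Mathlib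

open Matrix

/-- For `D` a full-rank `d × k` real matrix (`d ≤ k`) and `V, M` symmetric
positive definite `k × k` matrices, the matrices `D M Dᵗ`, `D M V M Dᵗ` and `D V⁻¹ Dᵗ` are
invertible and `D M Dᵗ [D M V M Dᵗ]⁻¹ D M Dᵗ ≤ D V⁻¹ Dᵗ` in the Loewner order, with
equality for `M = V⁻¹`. -/
theorem gmm_efficiency_bound_comparison
    (d k : ℕ) (hd : 0 < d) (hdk : d ≤ k)
    (D : Matrix (Fin d) (Fin k) ℝ) (hD : D.rank = d)
    (V : Matrix (Fin k) (Fin k) ℝ) (hV : V.PosDef)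
    (M : Matrix (Fin k) (Fin k) ℝ) (hM : M.PosDef) :
    IsUnit (D * M * Dᵀ) ∧ IsUnit (D * M * V * M * Dᵀ) ∧ IsUnit (D * V⁻¹ * Dᵀ) ∧
    (D * V⁻¹ * Dᵀ - D * M * Dᵀ * (D * M * V * M * Dᵀ)⁻¹ * (D * M * Dᵀ)).PosSemidef ∧
    D * V⁻¹ * Dᵀ * (D * V⁻¹ * Dᵀ)⁻¹ * (D * V⁻¹ * Dᵀ) = D * V⁻¹ * Dᵀ := by
  have hli : LinearIndependent ℝ D.row := by
    rw [linearIndependent_iff_card_eq_finrank_span, Set.finrank, ← D.rank_eq_finrank_span_row, hD,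
      Fintype.card_fin]
  have hinj : Function.Injective D.vecMul := Matrix.vecMul_injective_iff.2 hli
  have key : ∀ A : Matrix (Fin k) (Fin k) ℝ, A.PosDef → (D * A * Dᵀ).PosDef := by
    intro A hA
    have := hA.mul_mul_conjTranspose_same (B := D) hinj
    rwa [conjTranspose_eq_transpose_of_trivial] at this
  have hMT : Mᵀ = M := by
    have := hM.1.eq
    rwa [conjTranspose_eq_transpose_of_trivial] at this
  have hVT : Vᵀ = V := by
    have := hV.1.eq
    rwa [conjTranspose_eq_transpose_of_trivial] at this
  have hMVM : (M * V * M).PosDef := by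
    have := hV.mul_mul_conjTranspose_same (B := M)
      (Matrix.vecMul_injective_iff_isUnit.2 hM.isUnit)
    rwa [conjTranspose_eq_transpose_of_trivial, hMT] at this
  have h1 := key M hM
  have h2 := key _ hMVM
  have h3 := key _ hV.inv
  have e : D * (M * V * M) * Dᵀ = D * M * V * M * Dᵀ := by simp only [Matrix.mul_assoc]
  rw [e] at h2
  refine ⟨h1.isUnit, h2.isUnit, h3.isUnit, ?_, ?_⟩
  · have hWT : (D * M * V * M * Dᵀ)ᵀ = D * M * V * M * Dᵀ := by
      have := h2.1.eq
      rwa [conjTranspose_eq_transpose_of_trivial] at this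
    have hWu := (Matrix.isUnit_iff_isUnit_det _).1 h2.isUnit
    have hVu := (Matrix.isUnit_iff_isUnit_det _).1 hV.isUnit
    generalize hW : D * M * V * M * Dᵀ = W at *
    have hs := hV.posSemidef.conjTranspose_mul_mul_same
      (V⁻¹ * Dᵀ - M * Dᵀ * W⁻¹ * (D * M * Dᵀ))
    convert hs using 1
    have a1 : W⁻¹ * (D * M * V * M * Dᵀ) = 1 := by rw [hW]; exact Matrix.nonsing_inv_mul _ hWu
    have a2 : V⁻¹ * V = 1 := Matrix.nonsing_inv_mul _ hVu
    have a3 : V * V⁻¹ = 1 := Matrix.mul_nonsing_inv _ hVu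
    have c1 : (V⁻¹ * Dᵀ - M * Dᵀ * W⁻¹ * (D * M * Dᵀ))ᴴ
        = D * V⁻¹ - D * M * Dᵀ * W⁻¹ * (D * M) := by
      rw [conjTranspose_eq_transpose_of_trivial]
      simp only [transpose_sub, transpose_mul, transpose_transpose, transpose_nonsing_inv,
        hMT, hVT, hWT, Matrix.mul_assoc]
    rw [c1]
    have t1 : D * V⁻¹ * V = D := by rw [Matrix.mul_assoc, a2, Matrix.mul_one]
    have t2 : D * M * V * (V⁻¹ * Dᵀ) = D * M * Dᵀ := by
      rw [Matrix.mul_assoc (D * M), ← Matrix.mul_assoc V, a3, Matrix.one_mul]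
    have t3 : D * M * Dᵀ * W⁻¹ * (D * M) * V * (V⁻¹ * Dᵀ)
        = D * M * Dᵀ * W⁻¹ * (D * M * Dᵀ) := by
      rw [← t2]; simp only [Matrix.mul_assoc]
    have t4 : D * M * Dᵀ * W⁻¹ * (D * M) * V * (M * Dᵀ * W⁻¹ * (D * M * Dᵀ))
        = D * M * Dᵀ * W⁻¹ * (D * M * Dᵀ) := by
      calc _ = D * M * Dᵀ * (W⁻¹ * (D * M * V * M * Dᵀ)) * W⁻¹ * (D * M * Dᵀ) := by
            simp only [Matrix.mul_assoc]
        _ = _ := by rw [a1, Matrix.mul_one]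
    have t5 : D * (M * Dᵀ * W⁻¹ * (D * M * Dᵀ)) = D * M * Dᵀ * W⁻¹ * (D * M * Dᵀ) := by
      simp only [Matrix.mul_assoc]
    rw [Matrix.sub_mul, Matrix.sub_mul, Matrix.mul_sub, Matrix.mul_sub, t1, t3, t4, t5,
      sub_self, sub_zero, Matrix.mul_assoc D]
  · rw [Matrix.mul_nonsing_inv _ ((Matrix.isUnit_iff_isUnit_det _).1 h3.isUnit), Matrix.one_mul]
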